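/- Fix A > 0, L > 0, and U, φ₀, x_c ∈ ℝ, and let û(x) = A·exp(−(x−x_c)²/L² + i (x−x_c)² U / L + i φ₀). Let v_A, v_L, v_U, v_φ, v_{x_c} denote the partial derivatives of û with respect to A, L, U, φ₀, x_c respectively, and set c_A = A U/(4L), c_L = −U/2, c_U = (√2 A² L² − 2)/(4 L³), c_φ = 1/(4L²) − 5A²/(8√2), c_{x_c} = 1/2. Define the residual r(x) = c_A v_A(x) + c_L v_L(x) + c_U v_U(x) + c_φ v_φ(x) + c_{x_c} v_{x_c}(x) − [ −(1/2) û′(x) − (i/8) û″(x) − (i/2) |û(x)|² û(x) ]. Then Re ∫_ℝ v_k(x)* · r(x) dx = 0 for each k ∈ {A, L, U, φ, x_c}. -/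

import Mathlib

open MeasureTheory Real

theorem integrable_pow_mul_exp_neg_mul_sq {b : ℝ} (hb : 0 < b) (n : ℕ) :
    Integrable fun y : ℝ => y ^ n * exp (-b * y ^ 2) := by
  have h := integrable_rpow_mul_exp_neg_mul_sq hb (s := n) (by linarith [n.cast_nonneg (α := ℝ)])
  simpa only [rpow_natCast] using h

theorem hasDerivAt_pow_mul_exp_neg_mul_sq (b : ℝ) (n : ℕ) (y : ℝ) :
    HasDerivAt (fun y : ℝ => y ^ (n + 1) * exp (-b * y ^ 2))
      ((n + 1) * (y ^ n * exp (-b * y ^ 2)) - 2 * b * (y ^ (n + 2) * exp (-b * y ^ 2))) y := by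
  have h := (hasDerivAt_pow (n + 1) y).mul (((hasDerivAt_pow 2 y).const_mul (-b)).exp)
  refine h.congr_deriv ?_
  push_cast
  ring

theorem integral_pow_add_two_mul_exp_neg_mul_sq {b : ℝ} (hb : 0 < b) (n : ℕ) :
    ∫ y : ℝ, y ^ (n + 2) * exp (-b * y ^ 2) =
      (n + 1) / (2 * b) * ∫ y : ℝ, y ^ n * exp (-b * y ^ 2) := by
  have hn := (integrable_pow_mul_exp_neg_mul_sq hb n).const_mul ((n : ℝ) + 1)
  have hn2 := (integrable_pow_mul_exp_neg_mul_sq hb (n + 2)).const_mul (2 * b)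
  have h := integral_eq_zero_of_hasDerivAt_of_integrable
    (hasDerivAt_pow_mul_exp_neg_mul_sq b n) (hn.sub hn2)
    (integrable_pow_mul_exp_neg_mul_sq hb (n + 1))
  rw [integral_sub hn hn2, integral_const_mul, integral_const_mul] at h
  rw [div_mul_eq_mul_div, eq_div_iff (by positivity)]
  linarith

/-- Up to the factor `i A³` and the phase, the residual of the Gaussian ansatz at distance `y`
from its centre. -/
noncomputable def residualProfile (L y : ℝ) : ℝ :=
  √2 * y ^ 2 / (4 * L ^ 2) - 5 / (8 * √2) + exp (-2 * y ^ 2 / L ^ 2) / 2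

theorem integral_pow_mul_residualProfile {L : ℝ} (hL : 0 < L) (n : ℕ) :
    ∫ y : ℝ, y ^ n * residualProfile L y * exp (-2 * y ^ 2 / L ^ 2) =
      √2 * (n + 1) / 16 * (∫ y : ℝ, y ^ n * exp (-(2 / L ^ 2) * y ^ 2))
      - 5 / (8 * √2) * (∫ y : ℝ, y ^ n * exp (-(2 / L ^ 2) * y ^ 2))
      + 1 / 2 * ∫ y : ℝ, y ^ n * exp (-(4 / L ^ 2) * y ^ 2) := by
  have h2 : 0 < 2 / L ^ 2 := by positivity
  have h4 : 0 < 4 / L ^ 2 := by positivity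
  have i1 := (integrable_pow_mul_exp_neg_mul_sq h2 (n + 2)).const_mul (√2 / (4 * L ^ 2))
  have i2 := (integrable_pow_mul_exp_neg_mul_sq h2 n).const_mul (5 / (8 * √2))
  have i3 := (integrable_pow_mul_exp_neg_mul_sq h4 n).const_mul (1 / 2)
  have hfun : (fun y : ℝ => y ^ n * residualProfile L y * exp (-2 * y ^ 2 / L ^ 2)) = fun y =>
      √2 / (4 * L ^ 2) * (y ^ (n + 2) * exp (-(2 / L ^ 2) * y ^ 2))
      - 5 / (8 * √2) * (y ^ n * exp (-(2 / L ^ 2) * y ^ 2))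
      + 1 / 2 * (y ^ n * exp (-(4 / L ^ 2) * y ^ 2)) := by
    funext y
    have e2 : -(2 / L ^ 2) * y ^ 2 = -2 * y ^ 2 / L ^ 2 := by ring
    have e4 : exp (-(4 / L ^ 2) * y ^ 2) = exp (-2 * y ^ 2 / L ^ 2) ^ 2 := by
      rw [← exp_nat_mul]
      congr 1
      push_cast
      ring
    rw [e2, e4, residualProfile]
    ring
  have i12 := i1.sub i2
  simp only [Pi.sub_def] at i12
  rw [hfun, integral_add i12 i3, integral_sub i1 i2, integral_const_mul,
    integral_const_mul, integral_const_mul, integral_pow_add_two_mul_exp_neg_mul_sq h2]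
  field_simp
  ring

theorem integral_exp_neg_four_div_sq (L : ℝ) :
    ∫ y : ℝ, exp (-(4 / L ^ 2) * y ^ 2) = (∫ y : ℝ, exp (-(2 / L ^ 2) * y ^ 2)) / √2 := by
  rw [integral_gaussian, integral_gaussian, ← sqrt_div' _ (by norm_num)]
  congr 1
  field_simp
  ring

theorem integral_residualProfile {L : ℝ} (hL : 0 < L) :
    ∫ y : ℝ, residualProfile L y * exp (-2 * y ^ 2 / L ^ 2) = 0 := by
  have h := integral_pow_mul_residualProfile hL 0
  simp only [pow_zero, one_mul] at h
  rw [h, integral_exp_neg_four_div_sq]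
  have hs : √2 ^ 2 = 2 := sq_sqrt (by norm_num)
  field_simp
  rw [hs]
  norm_num

theorem integral_sq_mul_residualProfile {L : ℝ} (hL : 0 < L) :
    ∫ y : ℝ, y ^ 2 * residualProfile L y * exp (-2 * y ^ 2 / L ^ 2) = 0 := by
  have h2 := integral_pow_add_two_mul_exp_neg_mul_sq (b := 2 / L ^ 2) (by positivity) 0
  have h4 := integral_pow_add_two_mul_exp_neg_mul_sq (b := 4 / L ^ 2) (by positivity) 0
  simp only [pow_zero, one_mul, zero_add] at h2 h4
  rw [integral_pow_mul_residualProfile hL 2, h2, h4, integral_exp_neg_four_div_sq]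
  have hs : √2 ^ 2 = 2 := sq_sqrt (by norm_num)
  push_cast
  field_simp
  rw [hs]
  norm_num

theorem integral_mul_residualProfile (L : ℝ) :
    ∫ y : ℝ, y * residualProfile L y * exp (-2 * y ^ 2 / L ^ 2) = 0 := by
  have h := integral_neg_eq_self
    (fun y : ℝ => y * residualProfile L y * exp (-2 * y ^ 2 / L ^ 2)) volume
  simp only [residualProfile, neg_sq, neg_mul, integral_neg] at h ⊢
  linarith

theorem integral_const_mul_ofReal_eq_zero {F : ℝ → ℂ} {f : ℝ → ℝ} (K : ℂ) (c : ℝ)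
    (hf : ∫ y, f y = 0) (hF : ∀ x, F x = K * (f (x - c) : ℂ)) : (∫ x, F x).re = 0 := by
  simp only [hF]
  rw [integral_const_mul, integral_complex_ofReal, integral_sub_right_eq_self f c, hf]
  simp

/-- The unit-amplitude Gaussian wave packet. -/
noncomputable def wavePacket (l u p c x : ℂ) : ℂ :=
  Complex.exp (-(x - c) ^ 2 / l ^ 2 + Complex.I * (x - c) ^ 2 * u / l + Complex.I * p)

theorem hasDerivAt_wavePacket_width {l : ℂ} (hl : l ≠ 0) (u p c x : ℂ) :
    HasDerivAt (fun l => wavePacket l u p c x)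
      ((2 / l ^ 3 - Complex.I * u / l ^ 2) * (x - c) ^ 2 * wavePacket l u p c x) l := by
  have h := (((((hasDerivAt_id l).pow 2).fun_inv (pow_ne_zero 2 hl)).const_mul (-(x - c) ^ 2)).add
    (((hasDerivAt_id l).fun_inv hl).const_mul (Complex.I * (x - c) ^ 2 * u))).add_const
    (Complex.I * p)
  refine h.cexp.congr_deriv ?_
  simp only [wavePacket, id, Pi.add_apply, Pi.pow_apply, div_eq_mul_inv]
  field_simp
  ring

theorem hasDerivAt_wavePacket_chirp (l u p c x : ℂ) :
    HasDerivAt (fun u => wavePacket l u p c x)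
      (Complex.I * (x - c) ^ 2 / l * wavePacket l u p c x) u := by
  have h := ((((hasDerivAt_id u).const_mul (Complex.I * (x - c) ^ 2)).div_const l).const_add
    (-(x - c) ^ 2 / l ^ 2)).add_const (Complex.I * p)
  refine h.cexp.congr_deriv ?_
  simp only [wavePacket, id]
  ring

theorem hasDerivAt_wavePacket_phase (l u p c x : ℂ) :
    HasDerivAt (fun p => wavePacket l u p c x) (Complex.I * wavePacket l u p c x) p := by
  have h := ((hasDerivAt_id p).const_mul Complex.I).const_add
    (-(x - c) ^ 2 / l ^ 2 + Complex.I * (x - c) ^ 2 * u / l)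
  refine h.cexp.congr_deriv ?_
  simp only [wavePacket, id]
  ring

theorem hasDerivAt_wavePacket_position (l u p c x : ℂ) :
    HasDerivAt (fun x => wavePacket l u p c x)
      (2 * (-1 / l ^ 2 + Complex.I * u / l) * (x - c) * wavePacket l u p c x) x := by
  have h := (((((hasDerivAt_id x).sub_const c).pow 2).const_mul
    (-1 / l ^ 2 + Complex.I * u / l)).add_const (Complex.I * p)).cexp
  have hfun : (fun x => wavePacket l u p c x) = fun x =>
      Complex.exp ((-1 / l ^ 2 + Complex.I * u / l) * (x - c) ^ 2 + Complex.I * p) := by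
    funext x
    rw [wavePacket]
    ring_nf
  rw [hfun, congrFun hfun x]
  refine h.congr_deriv ?_
  simp only [id, Pi.pow_apply]
  push_cast
  ring

theorem hasDerivAt_wavePacket_center (l u p c x : ℂ) :
    HasDerivAt (fun c => wavePacket l u p c x)
      (-(2 * (-1 / l ^ 2 + Complex.I * u / l) * (x - c)) * wavePacket l u p c x) c := by
  have hfun : ∀ c x, wavePacket l u p c x = wavePacket l u p x c := fun c x => by
    rw [wavePacket, wavePacket, ← neg_sub c x, neg_sq]
  simp only [fun c => hfun c x]
  refine (hasDerivAt_wavePacket_position l u p x c).congr_deriv ?_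
  ring

theorem conj_wavePacket_mul_self (L U p c x : ℝ) :
    (starRingEnd ℂ) (wavePacket L U p c x) * wavePacket L U p c x =
      (exp (-2 * (x - c) ^ 2 / L ^ 2) : ℝ) := by
  rw [wavePacket, ← Complex.exp_conj, ← Complex.exp_add, Complex.ofReal_exp]
  congr 1
  simp only [map_add, map_mul, map_div₀, map_neg, map_pow, map_sub, Complex.conj_ofReal,
    Complex.conj_I]
  push_cast
  ring

/-- The RONS parameter velocities for NLS in the stationary frame with the translating
Gaussian ansatz — in particular the group velocity `ẋ_c = 1/2` — make the instantaneous
residual orthogonal, in the real part of the `L²(ℝ,ℂ)` inner product, to every tangent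
direction of the ansatz manifold. -/
theorem stmt14 (A L U φ₀ xc : ℝ) (hA : 0 < A) (hL : 0 < L) :
    let uh : ℝ → ℝ → ℝ → ℝ → ℝ → ℝ → ℂ := fun a l u p c x =>
      (a : ℂ) * Complex.exp (-((x : ℂ) - (c : ℂ)) ^ 2 / (l : ℂ) ^ 2
        + Complex.I * ((x : ℂ) - (c : ℂ)) ^ 2 * (u : ℂ) / (l : ℂ) + Complex.I * (p : ℂ))
    let vA : ℝ → ℂ := fun x => deriv (fun a => uh a L U φ₀ xc x) A
    let vL : ℝ → ℂ := fun x => deriv (fun l => uh A l U φ₀ xc x) L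
    let vU : ℝ → ℂ := fun x => deriv (fun u => uh A L u φ₀ xc x) U
    let vφ : ℝ → ℂ := fun x => deriv (fun p => uh A L U p xc x) φ₀
    let vxc : ℝ → ℂ := fun x => deriv (fun c => uh A L U φ₀ c x) xc
    let cA : ℝ := A * U / (4 * L)
    let cL : ℝ := -U / 2
    let cU : ℝ := (Real.sqrt 2 * A ^ 2 * L ^ 2 - 2) / (4 * L ^ 3)
    let cφ : ℝ := 1 / (4 * L ^ 2) - 5 * A ^ 2 / (8 * Real.sqrt 2)
    let cxc : ℝ := 1 / 2
    let r : ℝ → ℂ := fun x =>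
      (cA : ℂ) * vA x + (cL : ℂ) * vL x + (cU : ℂ) * vU x + (cφ : ℂ) * vφ x
        + (cxc : ℂ) * vxc x
        - (-(1 / 2 : ℂ) * deriv (fun y => uh A L U φ₀ xc y) x
           - (Complex.I / 8) * deriv (deriv (fun y => uh A L U φ₀ xc y)) x
           - (Complex.I / 2) * (‖uh A L U φ₀ xc x‖ : ℂ) ^ 2 * uh A L U φ₀ xc x)
    (∫ x : ℝ, (starRingEnd ℂ) (vA x) * r x).re = 0 ∧
    (∫ x : ℝ, (starRingEnd ℂ) (vL x) * r x).re = 0 ∧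
    (∫ x : ℝ, (starRingEnd ℂ) (vU x) * r x).re = 0 ∧
    (∫ x : ℝ, (starRingEnd ℂ) (vφ x) * r x).re = 0 ∧
    (∫ x : ℝ, (starRingEnd ℂ) (vxc x) * r x).re = 0 := by
  intro uh vA vL vU vφ vxc cA cL cU cφ cxc r
  have hL' : (L : ℂ) ≠ 0 := by exact_mod_cast hL.ne'
  have huh : ∀ a l u p c x : ℝ, uh a l u p c x = a * wavePacket l u p c x := fun _ _ _ _ _ _ => rfl
  set E : ℝ → ℂ := fun x => wavePacket L U φ₀ xc x with hE
  set γ : ℂ := -1 / (L : ℂ) ^ 2 + Complex.I * U / L with hγ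
  have hvA : ∀ x, vA x = E x := fun x => by
    exact ((hasDerivAt_id (A : ℂ)).mul_const (E x)).comp_ofReal.deriv.trans (one_mul _)
  have hvL : ∀ x, vL x =
      A * ((2 / (L : ℂ) ^ 3 - Complex.I * U / L ^ 2) * (x - xc) ^ 2 * E x) := fun x =>
    ((hasDerivAt_wavePacket_width hL' U φ₀ xc x).const_mul (A : ℂ)).comp_ofReal.deriv
  have hvU : ∀ x, vU x = A * (Complex.I * (x - xc) ^ 2 / L * E x) := fun x =>
    ((hasDerivAt_wavePacket_chirp L U φ₀ xc x).const_mul (A : ℂ)).comp_ofReal.deriv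
  have hvφ : ∀ x, vφ x = A * (Complex.I * E x) := fun x =>
    ((hasDerivAt_wavePacket_phase L U φ₀ xc x).const_mul (A : ℂ)).comp_ofReal.deriv
  have hvxc : ∀ x, vxc x = A * (-(2 * γ * (x - xc)) * E x) := fun x =>
    ((hasDerivAt_wavePacket_center L U φ₀ xc x).const_mul (A : ℂ)).comp_ofReal.deriv
  have hd1 : deriv (fun y => uh A L U φ₀ xc y) =
      fun x : ℝ => (A : ℂ) * (2 * γ * (x - xc) * E x) := funext fun x =>
    ((hasDerivAt_wavePacket_position L U φ₀ xc x).const_mul (A : ℂ)).comp_ofReal.deriv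
  have hd2 : ∀ x, deriv (deriv (fun y => uh A L U φ₀ xc y)) x =
      A * ((2 * γ + 4 * γ ^ 2 * (x - xc) ^ 2) * E x) := fun x => by
    rw [hd1]
    have h := ((((hasDerivAt_id (x : ℂ)).sub_const (xc : ℂ)).const_mul (2 * γ)).mul
      (hasDerivAt_wavePacket_position L U φ₀ xc x)).const_mul (A : ℂ)
    refine h.comp_ofReal.deriv.trans ?_
    simp only [id, hE, hγ]
    ring
  have hnorm : ∀ x, (‖uh A L U φ₀ xc x‖ : ℂ) ^ 2 =
      A ^ 2 * (exp (-2 * (x - xc) ^ 2 / L ^ 2) : ℝ) := fun x => by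
    rw [← conj_wavePacket_mul_self L U φ₀ xc x, ← Complex.conj_mul', huh, map_mul,
      Complex.conj_ofReal]
    ring
  have hr : ∀ x, r x = Complex.I * A ^ 3 * (residualProfile L (x - xc) : ℝ) * E x := fun x => by
    have hI := Complex.I_sq
    have hLL : (L : ℂ) ^ 2 * (L : ℂ)⁻¹ ^ 4 = (L : ℂ)⁻¹ ^ 2 := by field_simp
    simp only [r, hvA, hvL, hvU, hvφ, hvxc, hd2, hnorm]
    rw [hd1, huh, residualProfile]
    simp only [cA, cL, cU, cφ, cxc, hγ]
    push_cast
    linear_combination (A * E x * (U / (4 * L) - U * (x - xc) ^ 2 / L ^ 3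
      + Complex.I * U ^ 2 * (x - xc) ^ 2 / (2 * L ^ 2))) * hI
      + A ^ 3 * E x * Complex.I * (x - xc) ^ 2 * (√2 : ℝ) / 4 * hLL
  have hG : ∀ x, (starRingEnd ℂ) (E x) * E x = (exp (-2 * (x - xc) ^ 2 / L ^ 2) : ℝ) :=
    conj_wavePacket_mul_self L U φ₀ xc
  have hpair : ∀ (v : ℝ → ℂ) (k : ℂ) (n : ℕ), (∀ x, v x = k * (x - xc) ^ n * E x) →
      (∫ y : ℝ, y ^ n * residualProfile L y * exp (-2 * y ^ 2 / L ^ 2) = 0) →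
      (∫ x : ℝ, (starRingEnd ℂ) (v x) * r x).re = 0 := fun v k n hv h0 => by
    refine integral_const_mul_ofReal_eq_zero (Complex.I * A ^ 3 * (starRingEnd ℂ) k) xc h0
      fun x => ?_
    rw [hv, hr, Complex.ofReal_mul, ← hG]
    simp only [map_mul, map_pow, map_sub, Complex.conj_ofReal]
    push_cast
    ring
  refine ⟨hpair vA 1 0 (fun x => ?_) ?_,
    hpair vL (A * (2 / (L : ℂ) ^ 3 - Complex.I * U / L ^ 2)) 2 (fun x => ?_)
      (integral_sq_mul_residualProfile hL),
    hpair vU (A * Complex.I / L) 2 (fun x => ?_) (integral_sq_mul_residualProfile hL),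
    hpair vφ (A * Complex.I) 0 (fun x => ?_) ?_,
    hpair vxc (-(2 * A * γ)) 1 (fun x => ?_) ?_⟩
  · rw [hvA]; ring
  · simpa using integral_residualProfile hL
  · rw [hvL]; ring
  · rw [hvU]; ring
  · rw [hvφ]; ring
  · simpa using integral_residualProfile hL
  · rw [hvxc]; ring
  · simpa using integral_mul_residualProfile L
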